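/- arXiv:2012.08632 — 2 statements merged into one kernel-verified Lean document; each statement's English description precedes it below -/
import Mathlib

section
/- Let ℓ ≥ 8 and let C⃗ be any orientation of the cycle C_ℓ. If G is a graph with m(G) < (ℓ−1)/(ℓ−2), then some orientation of G contains no copy of C⃗. -/
/-- An orientation of a simple graph `G`: an assignment of a direction to each edge. -/
structure GraphOrientation {V : Type*} (G : SimpleGraph V) where
  adj : V → V → Prop
  le : ∀ {u v}, adj u v → G.Adj u v
  total : ∀ {u v}, G.Adj u v → adj u v ∨ adj v u
  asymm : ∀ {u v}, adj u v → ¬ adj v u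

open Classical in
/-- If every subgraph has density below `7/6`, then every nonempty vertex set induces a graph with
a vertex of degree at most one or with two adjacent vertices of degree at most two. -/
theorem exists_degree_le_one_or_adj_degree_le_two {V : Type*} [Fintype V] {G : SimpleGraph V}
    (hG : ∀ J : G.Subgraph, J.verts.Nonempty → 6 * J.edgeSet.ncard < 7 * J.verts.ncard)
    (S : Finset V) (hS : S.Nonempty) :
    (∃ w ∈ S, (S.filter (G.Adj w)).card ≤ 1) ∨
      ∃ u ∈ S, ∃ v ∈ S, G.Adj u v ∧ (S.filter (G.Adj u)).card ≤ 2 ∧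
        (S.filter (G.Adj v)).card ≤ 2 := by
  by_contra! hcon
  obtain ⟨h1, h2⟩ := hcon
  set d : V → ℕ := fun w => (S.filter (G.Adj w)).card with hd
  set J : G.Subgraph := (⊤ : G.Subgraph).induce (S : Set V) with hJ
  have hsum : ∑ w ∈ S, d w = 2 * J.edgeSet.ncard := by
    have h := J.spanningCoe.sum_degrees_eq_twice_card_edges
    rw [← Set.ncard_coe_finset, SimpleGraph.coe_edgeFinset, SimpleGraph.Subgraph.edgeSet_spanningCoe]
      at h
    rw [← h, ← Finset.sum_subset (Finset.subset_univ S)]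
    · refine Finset.sum_congr rfl fun w hw => ?_
      rw [← SimpleGraph.card_neighborFinset_eq_degree]
      refine congrArg Finset.card ?_
      ext x
      simp [hJ, hw]
    · intro w _ hw
      rw [← SimpleGraph.card_neighborFinset_eq_degree, Finset.card_eq_zero]
      ext x
      simp [hJ, hw]
  have hlt := hG J (by simpa [hJ] using hS)
  have hv : J.verts.ncard = S.card := by simp [hJ]
  rw [hv] at hlt
  set A := S.filter (fun w => d w ≤ 2) with hA
  set B := S.filter (fun w => ¬ d w ≤ 2) with hB
  have hcard : A.card + B.card = S.card := Finset.card_filter_add_card_filter_not _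
  have hsplit : ∑ w ∈ A, d w + ∑ w ∈ B, d w = ∑ w ∈ S, d w :=
    Finset.sum_filter_add_sum_filter_not _ _ _
  have hA2 : A.card * 2 ≤ ∑ w ∈ A, d w := by
    rw [← smul_eq_mul]
    exact Finset.card_nsmul_le_sum _ _ _ fun w hw => h1 w (Finset.mem_filter.1 hw).1
  have hB3 : B.card * 3 ≤ ∑ w ∈ B, d w := by
    rw [← smul_eq_mul]
    exact Finset.card_nsmul_le_sum _ _ _ fun w hw => by
      have := (Finset.mem_filter.1 hw).2
      omega
  have hAB : ∑ w ∈ A, d w ≤ ∑ w ∈ B, d w := by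
    calc ∑ w ∈ A, d w ≤ ∑ w ∈ A, (B.bipartiteAbove G.Adj w).card := by
          refine Finset.sum_le_sum fun w hw => Finset.card_le_card fun x hx => ?_
          rw [hA, Finset.mem_filter] at hw
          rw [Finset.mem_filter] at hx
          have := h2 w hw.1 x hx.1 hx.2 hw.2
          simp only [Finset.mem_bipartiteAbove, hB, Finset.mem_filter]
          exact ⟨⟨hx.1, by simp only [hd]; omega⟩, hx.2⟩
      _ = ∑ x ∈ B, (A.bipartiteBelow G.Adj x).card :=
          Finset.sum_card_bipartiteAbove_eq_sum_card_bipartiteBelow _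
      _ ≤ ∑ x ∈ B, d x := by
          refine Finset.sum_le_sum fun x _ => Finset.card_le_card fun w hw => ?_
          rw [Finset.mem_bipartiteBelow, hA, Finset.mem_filter] at hw
          exact Finset.mem_filter.2 ⟨hw.1.1, hw.2.symm⟩
  omega

open Classical in
/-- If every nonempty vertex set induces a graph with a vertex of degree at most two, then the
graph is `3`-colourable. -/
theorem colorable_three_of_degree_le_two {V : Type*} [Fintype V] {G : SimpleGraph V}
    (hG : ∀ S : Finset V, S.Nonempty → ∃ w ∈ S, (S.filter (G.Adj w)).card ≤ 2) :
    G.Colorable 3 := by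
  have key : ∀ S : Finset V, ∃ c : V → Fin 3, ∀ x ∈ S, ∀ y ∈ S, G.Adj x y → c x ≠ c y := by
    intro S
    induction S using Finset.strongInduction with
    | H S ih =>
      rcases S.eq_empty_or_nonempty with rfl | hS
      · exact ⟨fun _ => 0, by simp⟩
      obtain ⟨w, hw, hdeg⟩ := hG S hS
      obtain ⟨c, hc⟩ := ih (S.erase w) (Finset.erase_ssubset hw)
      obtain ⟨a, ha⟩ : ∃ a, a ∉ (S.filter (G.Adj w)).image c := by
        by_contra! h
        have h3 : (Finset.univ : Finset (Fin 3)).card ≤ ((S.filter (G.Adj w)).image c).card :=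
          Finset.card_le_card fun a _ => h a
        have := Finset.card_image_le (s := S.filter (G.Adj w)) (f := c)
        simp only [Finset.card_univ, Fintype.card_fin] at h3
        omega
      have ha' : ∀ x ∈ S, G.Adj w x → a ≠ c x := fun x hx hwx h =>
        ha (Finset.mem_image.2 ⟨x, Finset.mem_filter.2 ⟨hx, hwx⟩, h.symm⟩)
      refine ⟨Function.update c w a, fun x hx y hy hxy => ?_⟩
      by_cases hxw : x = w
      · subst hxw
        rw [Function.update_self, Function.update_of_ne hxy.ne']
        exact ha' y hy hxy
      · by_cases hyw : y = w
        · subst hyw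
          rw [Function.update_self, Function.update_of_ne hxw]
          exact (ha' x hx hxy.symm).symm
        · rw [Function.update_of_ne hxw, Function.update_of_ne hyw]
          exact hc x (by simp [hxw, hx]) y (by simp [hyw, hy]) hxy
  obtain ⟨c, hc⟩ := key Finset.univ
  exact ⟨SimpleGraph.Coloring.mk c fun {x y} h => hc x (by simp) y (by simp) h⟩

/-- The orientation of a graph along a proper colouring with linearly ordered colours. -/
def GraphOrientation.ofColoring {V α : Type*} [LinearOrder α] {G : SimpleGraph V}
    (c : G.Coloring α) : GraphOrientation G where
  adj x y := G.Adj x y ∧ c x < c y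
  le h := h.1
  total h := (lt_or_gt_of_ne (c.valid h)).imp (fun h' => ⟨h, h'⟩) fun h' => ⟨h.symm, h'⟩
  asymm h h' := lt_asymm h.2 h'.2

/-- The orientation obtained from `o` by redirecting all edges at `u` towards `u` and all edges at
`v` away from `v`, except that `u` points to `v`. -/
def GraphOrientation.redirect {V : Type*} {G : SimpleGraph V} (o : GraphOrientation G) {u v : V}
    (huv : u ≠ v) : GraphOrientation G where
  adj x y := G.Adj x y ∧ ((x ≠ v ∧ y = u) ∨ (x = u ∧ y = v) ∨ (x = v ∧ y ≠ u) ∨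
    (x ≠ u ∧ x ≠ v ∧ y ≠ u ∧ y ≠ v ∧ o.adj x y))
  le h := h.1
  total {x y} h := by
    have h1 := o.total h
    have h2 := h.symm
    have h3 := h.ne
    grind
  asymm {x y} h h' := by
    have h3 := h.1.ne
    have h4 : o.adj x y → ¬ o.adj y x := o.asymm
    grind

/-- `f` is a copy in `o` of the cycle oriented by `σ`. -/
def GraphOrientation.IsCycleCopy {V : Type*} {G : SimpleGraph V} (o : GraphOrientation G) {n : ℕ}
    (σ : Fin (n + 8) → Bool) (f : Fin (n + 8) → V) : Prop :=
  Function.Injective f ∧ ∀ i : Fin (n + 8), (σ i = true → o.adj (f i) (f (i + 1))) ∧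
    (σ i = false → o.adj (f (i + 1)) (f i))

namespace GraphOrientation.IsCycleCopy

variable {V : Type*} {G : SimpleGraph V} {o : GraphOrientation G} {n : ℕ}
  {σ : Fin (n + 8) → Bool} {f : Fin (n + 8) → V}

theorem adj_succ (hf : o.IsCycleCopy σ f) (i : Fin (n + 8)) : G.Adj (f i) (f (i + 1)) := by
  cases h : σ i
  · exact (o.le ((hf.2 i).2 h)).symm
  · exact o.le ((hf.2 i).1 h)

theorem ne_add_two (hf : o.IsCycleCopy σ f) (i : Fin (n + 8)) : f i ≠ f (i + 1 + 1) := by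
  intro h
  have h2 : (1 + 1 : Fin (n + 8)) = 0 := by simpa [add_assoc] using hf.1 h
  have := congrArg Fin.val h2
  simp [Fin.val_add, Nat.mod_eq_of_lt] at this

theorem eq_true (hf : o.IsCycleCopy σ f) {i : Fin (n + 8)} (h : o.adj (f i) (f (i + 1))) :
    σ i = true := by
  by_contra hσ
  exact o.asymm h ((hf.2 i).2 (by simpa using hσ))

theorem eq_false (hf : o.IsCycleCopy σ f) {i : Fin (n + 8)} (h : o.adj (f (i + 1)) (f i)) :
    σ i = false := by
  by_contra hσ
  exact o.asymm h ((hf.2 i).1 (by simpa using hσ))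

open Classical in
theorem two_le_card_filter_adj (hf : o.IsCycleCopy σ f) {S : Finset V} (hS : ∀ i, f i ∈ S)
    (i : Fin (n + 8)) : 2 ≤ (S.filter (G.Adj (f (i + 1)))).card := by
  rw [← Finset.card_pair (hf.ne_add_two i)]
  refine Finset.card_le_card fun x hx => ?_
  have h1 := hf.adj_succ i
  have h2 := hf.adj_succ (i + 1)
  rw [Finset.mem_insert, Finset.mem_singleton] at hx
  rcases hx with rfl | rfl
  · exact Finset.mem_filter.2 ⟨hS _, h1.symm⟩
  · exact Finset.mem_filter.2 ⟨hS _, h2⟩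

open Classical in
theorem eq_or_eq_of_card_filter_adj_le_two (hf : o.IsCycleCopy σ f) {S : Finset V}
    (hS : ∀ i, f i ∈ S) {i : Fin (n + 8)} {v : V} (hv : v ∈ S) (hadj : G.Adj (f (i + 1)) v)
    (hcard : (S.filter (G.Adj (f (i + 1)))).card ≤ 2) : v = f i ∨ v = f (i + 1 + 1) := by
  by_contra! h
  have h3 : ({v, f i, f (i + 1 + 1)} : Finset V).card = 3 := by
    rw [Finset.card_eq_three]
    exact ⟨_, _, _, h.1, h.2, hf.ne_add_two i, rfl⟩
  have : ({v, f i, f (i + 1 + 1)} : Finset V) ⊆ S.filter (G.Adj (f (i + 1))) := by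
    have h1 := hf.adj_succ i
    have h2 := hf.adj_succ (i + 1)
    intro x hx
    simp only [Finset.mem_insert, Finset.mem_singleton] at hx
    rcases hx with rfl | rfl | rfl
    · exact Finset.mem_filter.2 ⟨hv, hadj⟩
    · exact Finset.mem_filter.2 ⟨hS _, h1.symm⟩
    · exact Finset.mem_filter.2 ⟨hS _, h2⟩
  have := Finset.card_le_card this
  omega

/-- Two consecutive vertices `u, v` of a cycle in a redirected orientation lie in the middle of a
directed path with three edges. -/
theorem exists_three_eq_of_redirect {u v : V} {huv : u ≠ v}
    (hf : (o.redirect huv).IsCycleCopy σ f) {i : Fin (n + 8)}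
    (h : (f (i + 1) = u ∧ f (i + 1 + 1) = v) ∨ (f (i + 1) = v ∧ f (i + 1 + 1) = u)) :
    σ i = σ (i + 1) ∧ σ (i + 1) = σ (i + 1 + 1) := by
  have a0 := hf.adj_succ i
  have a1 := hf.adj_succ (i + 1)
  have a2 := hf.adj_succ (i + 1 + 1)
  have n0 := hf.ne_add_two i
  have n1 := hf.ne_add_two (i + 1)
  rcases h with ⟨h1, h2⟩ | ⟨h1, h2⟩
  · rw [h2] at n0
    rw [h1] at n1
    rw [hf.eq_true (i := i) ⟨a0, .inl ⟨n0, h1⟩⟩,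
      hf.eq_true (i := i + 1) ⟨a1, .inr (.inl ⟨h1, h2⟩)⟩,
      hf.eq_true (i := i + 1 + 1) ⟨a2, .inr (.inr (.inl ⟨h2, n1.symm⟩))⟩]
    simp
  · rw [h2] at n0
    rw [h1] at n1
    rw [hf.eq_false (i := i) ⟨a0.symm, .inr (.inr (.inl ⟨h1, n0⟩))⟩,
      hf.eq_false (i := i + 1) ⟨a1.symm, .inr (.inl ⟨h2, h1⟩)⟩,
      hf.eq_false (i := i + 1 + 1) ⟨a2.symm, .inl ⟨n1.symm, h2⟩⟩]
    simp

end GraphOrientation.IsCycleCopy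

open Classical in
/-- An oriented cycle without a directed path with three edges can be avoided by orienting each
path through two adjacent vertices of degree two as a directed path. -/
theorem exists_orientation_of_no_directed_path {V : Type*} {G : SimpleGraph V} {n : ℕ}
    {σ : Fin (n + 8) → Bool}
    (hσ : ∀ i, ¬ (σ i = σ (i + 1) ∧ σ (i + 1) = σ (i + 1 + 1)))
    (hG : ∀ S : Finset V, S.Nonempty → (∃ w ∈ S, (S.filter (G.Adj w)).card ≤ 1) ∨
      ∃ u ∈ S, ∃ v ∈ S, G.Adj u v ∧ (S.filter (G.Adj u)).card ≤ 2 ∧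
        (S.filter (G.Adj v)).card ≤ 2) (S : Finset V) :
    ∃ o : GraphOrientation G, ∀ f, o.IsCycleCopy σ f → ¬ ∀ i, f i ∈ S := by
  induction S using Finset.strongInduction with
  | H S ih =>
    rcases S.eq_empty_or_nonempty with rfl | hS
    · let : LinearOrder V := IsWellOrder.linearOrder WellOrderingRel
      exact ⟨.ofColoring G.selfColoring, fun f _ h => by simpa using h 0⟩
    rcases hG S hS with ⟨w, hw, hdeg⟩ | ⟨u, hu, v, hv, huv, hdu, hdv⟩
    · obtain ⟨o, ho⟩ := ih (S.erase w) (Finset.erase_ssubset hw)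
      refine ⟨o, fun f hf hfS => ho f hf fun i => Finset.mem_erase.2 ⟨?_, hfS i⟩⟩
      rintro rfl
      have := hf.two_le_card_filter_adj hfS (i - 1)
      rw [sub_add_cancel] at this
      omega
    · obtain ⟨o, ho⟩ := ih ((S.erase u).erase v)
        ((Finset.erase_subset _ _).trans_ssubset (Finset.erase_ssubset hu))
      refine ⟨o.redirect huv.ne, fun f hf hfS => ?_⟩
      have havoid : ∀ i, f (i + 1) ≠ u ∧ f (i + 1) ≠ v := by
        intro i
        obtain ⟨j, rfl⟩ : ∃ j, i = j + 1 := ⟨i - 1, by simp⟩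
        refine ⟨fun h => ?_, fun h => ?_⟩
        · rcases hf.eq_or_eq_of_card_filter_adj_le_two hfS hv (by rwa [h]) (by rwa [h]) with h' | h'
          · exact hσ _ (hf.exists_three_eq_of_redirect (.inr ⟨h'.symm, h⟩))
          · exact hσ _ (hf.exists_three_eq_of_redirect (.inl ⟨h, h'.symm⟩))
        · rcases hf.eq_or_eq_of_card_filter_adj_le_two hfS hu (by rw [h]; exact huv.symm)
            (by rwa [h]) with h' | h'
          · exact hσ _ (hf.exists_three_eq_of_redirect (.inl ⟨h'.symm, h⟩))
          · exact hσ _ (hf.exists_three_eq_of_redirect (.inr ⟨h, h'.symm⟩))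
      have havoid' : ∀ i, f i ≠ u ∧ f i ≠ v := fun i => by
        simpa only [sub_add_cancel] using havoid (i - 1)
      refine ho f ⟨hf.1, fun i => ⟨fun h => ?_, fun h => ?_⟩⟩ fun i => ?_
      · have := ((hf.2 i).1 h).2
        have := havoid' i
        have := havoid' (i + 1)
        tauto
      · have := ((hf.2 i).2 h).2
        have := havoid' i
        have := havoid' (i + 1)
        tauto
      · simp [havoid' i, hfS i]

/-- Let `ℓ = n + 8 ≥ 8` and let `C⃗` be any orientation of the cycle
`C_ℓ` (encoded by `σ : Fin ℓ → Bool`, where `σ i = true` means the edge `{i, i+1}`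
is directed `i → i+1`).  If `G` is a graph with `m(G) < (ℓ-1)/(ℓ-2)`, then some
orientation of `G` contains no copy of `C⃗`. -/
theorem not_oriented_ramsey_cycle_ge_8 {V : Type*} [Fintype V]
    (n : ℕ) (σ : Fin (n + 8) → Bool)
    (G : SimpleGraph V)
    (hm : ∀ J : G.Subgraph, J.verts.Nonempty →
      (J.edgeSet.ncard : ℚ) < (((n : ℚ) + 7) / ((n : ℚ) + 6)) * J.verts.ncard) :
    ∃ o : GraphOrientation G, ¬ ∃ f : Fin (n + 8) → V, Function.Injective f ∧
      ∀ i : Fin (n + 8), (σ i = true → o.adj (f i) (f (i + 1))) ∧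
        (σ i = false → o.adj (f (i + 1)) (f i)) := by
  classical
  have hG : ∀ J : G.Subgraph, J.verts.Nonempty → 6 * J.edgeSet.ncard < 7 * J.verts.ncard := by
    intro J hJ
    have h := hm J hJ
    have hle : ((n : ℚ) + 7) / ((n : ℚ) + 6) ≤ 7 / 6 := by
      rw [div_le_div_iff₀ (by positivity) (by norm_num)]
      linarith [n.cast_nonneg (α := ℚ)]
    have h' := h.trans_le (mul_le_mul_of_nonneg_right hle (Nat.cast_nonneg J.verts.ncard))
    have h6 : (6 * J.edgeSet.ncard : ℚ) < 7 * J.verts.ncard := by linarith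
    exact_mod_cast h6
  have hstruct := exists_degree_le_one_or_adj_degree_le_two hG
  by_cases hσ : ∃ i, σ i = σ (i + 1) ∧ σ (i + 1) = σ (i + 1 + 1)
  · obtain ⟨i, h1, h2⟩ := hσ
    obtain ⟨c⟩ := colorable_three_of_degree_le_two (G := G) fun S hS => by
      rcases hstruct S hS with ⟨w, hw, h⟩ | ⟨u, hu, -, -, -, h, -⟩
      · exact ⟨w, hw, by omega⟩
      · exact ⟨u, hu, h⟩
    refine ⟨.ofColoring c, ?_⟩
    rintro ⟨f, -, hf⟩
    cases h : σ i
    · have a0 := ((hf i).2 h).2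
      have a1 := ((hf (i + 1)).2 (h1 ▸ h)).2
      have a2 := ((hf (i + 1 + 1)).2 (h2 ▸ h1 ▸ h)).2
      omega
    · have a0 := ((hf i).1 h).2
      have a1 := ((hf (i + 1)).1 (h1 ▸ h)).2
      have a2 := ((hf (i + 1 + 1)).1 (h2 ▸ h1 ▸ h)).2
      omega
  · obtain ⟨o, ho⟩ := exists_orientation_of_no_directed_path (not_exists.1 hσ) hstruct Finset.univ
    exact ⟨o, fun ⟨f, hf⟩ => ho f hf fun i => Finset.mem_univ _⟩
end

section
/- Let ℓ ≥ 5 and let C⃗ be any orientation of the cycle C_ℓ. If G is a graph with m(G) < (ℓ−1)/(ℓ−2), then some orientation of G contains no copy of C⃗. -/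
open Finset in
/-- The number of neighbours of `v` inside `S`. -/
noncomputable def degIn {V : Type*} (G : SimpleGraph V) (S : Finset V) (v : V) : ℕ :=
  open Classical in #{w ∈ S | G.Adj v w}

/-- `f` embeds the oriented cycle encoded by `σ` into the orientation `o`. -/
def IsCopy {V : Type*} {G : SimpleGraph V} {n : ℕ} (o : GraphOrientation G)
    (σ : Fin (n + 5) → Bool) (f : Fin (n + 5) → V) : Prop :=
  Function.Injective f ∧ ∀ i : Fin (n + 5), (σ i = true → o.adj (f i) (f (i + 1))) ∧
    (σ i = false → o.adj (f (i + 1)) (f i))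

/-- Some orientation of `G` has no copy of the oriented cycle `σ` inside `S`. -/
def AvoidableOn {V : Type*} {n : ℕ} (G : SimpleGraph V) (σ : Fin (n + 5) → Bool)
    (S : Finset V) : Prop :=
  ∃ o : GraphOrientation G, ∀ f, IsCopy o σ f → ¬ ∀ i, f i ∈ S

namespace GraphOrientation

variable {V : Type*} {G : SimpleGraph V}

/-- Reverse every edge. -/
def reverse (o : GraphOrientation G) : GraphOrientation G where
  adj u v := o.adj v u
  le h := (o.le h).symm
  total h := o.total h.symm
  asymm h := o.asymm h

/-- Direct edges along `R` where `R` applies, and along `o` elsewhere. -/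
def override (o : GraphOrientation G) (R : V → V → Prop) (hR : ∀ u v, R u v → ¬ R v u) :
    GraphOrientation G where
  adj u v := G.Adj u v ∧ (R u v ∨ ¬ R v u ∧ o.adj u v)
  le h := h.1
  total {u v} h := by
    have := h.symm
    have := o.total h
    tauto
  asymm {u v} h h' := by
    have := hR u v
    have : o.adj u v → ¬ o.adj v u := o.asymm
    tauto

/-- Direct edges along an asymmetric relation that decides every edge. -/
def ofRel (R : V → V → Prop) (hR : ∀ u v, R u v → ¬ R v u)
    (htot : ∀ u v, G.Adj u v → R u v ∨ R v u) : GraphOrientation G where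
  adj u v := G.Adj u v ∧ R u v
  le h := h.1
  total {u v} h := by
    have := h.symm
    have := htot u v h
    tauto
  asymm {u v} h h' := hR u v h.2 h'.2

end GraphOrientation

section Density

variable {V : Type*} {G : SimpleGraph V}

open Finset

open Classical in
theorem sum_degIn_eq_twice_ncard_edgeSet [Fintype V] (S : Finset V) :
    ∑ v ∈ S, degIn G S v = 2 * ((⊤ : G.Subgraph).induce (S : Set V)).edgeSet.ncard := by
  set J := (⊤ : G.Subgraph).induce (S : Set V) with hJ
  have h := J.spanningCoe.sum_degrees_eq_twice_card_edges
  have hdeg : ∀ v, J.spanningCoe.degree v = if v ∈ S then degIn G S v else 0 := by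
    intro v
    rw [← SimpleGraph.card_neighborFinset_eq_degree]
    split_ifs with hv
    · unfold degIn
      congr 1
      ext w
      simp [hJ, hv]
    · rw [Finset.card_eq_zero]
      ext w
      simp [hJ, hv]
  simp only [hdeg, Finset.sum_ite_mem, Finset.univ_inter] at h
  rw [h, ← Set.ncard_coe_finset, SimpleGraph.coe_edgeFinset]
  rfl

theorem density_degIn [Fintype V] (n : ℕ)
    (hm : ∀ J : G.Subgraph, J.verts.Nonempty →
      (J.edgeSet.ncard : ℚ) < (((n : ℚ) + 4) / ((n : ℚ) + 3)) * J.verts.ncard)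
    (S : Finset V) (hS : S.Nonempty) :
    (n + 3) * ∑ v ∈ S, degIn G S v < 2 * (n + 4) * #S := by
  have h := hm ((⊤ : G.Subgraph).induce (S : Set V)) (by simpa using hS)
  rw [sum_degIn_eq_twice_ncard_edgeSet]
  rw [SimpleGraph.Subgraph.induce_verts, Set.ncard_coe_finset, div_mul_eq_mul_div,
    lt_div_iff₀ (by positivity)] at h
  norm_cast at h
  linarith

open Classical in
theorem sum_card_degIn_eq_two (S : Finset V) :
    ∑ v ∈ S, #{w ∈ S | G.Adj v w ∧ degIn G S w = 2} =
      ∑ v ∈ S, if degIn G S v = 2 then 2 else 0 := by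
  simp only [card_filter]
  rw [sum_comm]
  refine sum_congr rfl fun w _ => ?_
  split_ifs with h
  · simp only [h, and_true, G.adj_comm _ w]
    rw [← h, degIn, card_filter]
  · simp [h]

open Classical in
theorem card_degIn_eq_two_le (S : Finset V) (v : V) :
    #{w ∈ S | G.Adj v w ∧ degIn G S w = 2} ≤ degIn G S v :=
  card_le_card fun w hw => by
    simp only [mem_filter] at hw ⊢
    tauto

open Classical in
theorem card_degIn_eq_two_eq_zero {S : Finset V}
    (hadj : ∀ a ∈ S, ∀ b ∈ S, G.Adj a b → degIn G S a = 2 → degIn G S b ≠ 2)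
    {v : V} (hv : v ∈ S) (h : degIn G S v = 2) :
    #{w ∈ S | G.Adj v w ∧ degIn G S w = 2} = 0 := by
  rw [card_eq_zero, filter_eq_empty_iff]
  rintro w hw ⟨h1, h2⟩
  exact hadj v hv w hw h1 h h2

theorem exists_adj_degIn_eq_two {S : Finset V} (hS : 5 * ∑ v ∈ S, degIn G S v < 12 * #S)
    (hmin : ∀ v ∈ S, 2 ≤ degIn G S v) :
    ∃ a ∈ S, ∃ b ∈ S, G.Adj a b ∧ degIn G S a = 2 ∧ degIn G S b = 2 := by
  classical
  by_contra! hadj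
  have key : ∑ v ∈ S, (12 + #{w ∈ S | G.Adj v w ∧ degIn G S w = 2}) ≤
      ∑ v ∈ S, (5 * degIn G S v + if degIn G S v = 2 then 2 else 0) := by
    refine sum_le_sum fun v hv => ?_
    have := card_degIn_eq_two_le (G := G) S v
    have := hmin v hv
    split_ifs with h
    · have := card_degIn_eq_two_eq_zero hadj hv h
      omega
    · omega
  rw [sum_add_distrib, sum_add_distrib, sum_card_degIn_eq_two, ← mul_sum] at key
  simp only [sum_const, smul_eq_mul] at key
  omega

theorem exists_adj_degIn_eq_two_or_claw {S : Finset V}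
    (hS : 2 * ∑ v ∈ S, degIn G S v < 5 * #S) (hmin : ∀ v ∈ S, 2 ≤ degIn G S v) :
    (∃ a ∈ S, ∃ b ∈ S, G.Adj a b ∧ degIn G S a = 2 ∧ degIn G S b = 2) ∨
      ∃ c ∈ S, degIn G S c = 3 ∧ ∀ a ∈ S, G.Adj c a → degIn G S a = 2 := by
  classical
  by_contra! hcon
  obtain ⟨hadj, hclaw⟩ := hcon
  have key : ∑ v ∈ S, (10 + #{w ∈ S | G.Adj v w ∧ degIn G S w = 2}) ≤
      ∑ v ∈ S, (4 * degIn G S v + if degIn G S v = 2 then 2 else 0) := by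
    refine sum_le_sum fun v hv => ?_
    have := card_degIn_eq_two_le (G := G) S v
    have := hmin v hv
    split_ifs with h
    · have := card_degIn_eq_two_eq_zero hadj hv h
      omega
    · by_cases h3 : degIn G S v = 3
      · obtain ⟨a, ha, hva, hda⟩ := hclaw v hv h3
        have : #{w ∈ S | G.Adj v w ∧ degIn G S w = 2} < degIn G S v := by
          refine card_lt_card ((ssubset_iff_of_subset fun w hw => ?_).2 ⟨a, ?_, ?_⟩)
          · simp only [mem_filter] at hw ⊢
            tauto
          · simp [ha, hva]
          · simp [hda]
        omega
      · omega
  rw [sum_add_distrib, sum_add_distrib, sum_card_degIn_eq_two, ← mul_sum] at key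
  simp only [sum_const, smul_eq_mul] at key
  omega

theorem exists_coloring_three
    (hd : ∀ S : Finset V, S.Nonempty → 3 * ∑ v ∈ S, degIn G S v < 8 * #S) (S : Finset V) :
    ∃ c : V → Fin 3, ∀ u ∈ S, ∀ v ∈ S, G.Adj u v → c u ≠ c v := by
  classical
  induction S using Finset.strongInduction with
  | H S ih =>
    rcases S.eq_empty_or_nonempty with rfl | hS
    · exact ⟨0, by simp⟩
    have hlow : ∃ v ∈ S, degIn G S v < 3 := by
      by_contra! h
      have h1 := card_nsmul_le_sum S (fun v => degIn G S v) 3 h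
      have := hd S hS
      simp only [smul_eq_mul] at h1
      omega
    obtain ⟨v, hv, hdeg⟩ := hlow
    obtain ⟨c, hc⟩ := ih (S.erase v) (erase_ssubset hv)
    obtain ⟨x, hx⟩ : ∃ x, x ∉ ({w ∈ S | G.Adj v w}).image c := by
      by_contra! h
      have h1 := card_le_card (fun x _ => h x : (univ : Finset (Fin 3)) ⊆ _)
      have h2 := h1.trans card_image_le
      simp only [card_univ, Fintype.card_fin] at h2
      unfold degIn at hdeg
      omega
    simp only [mem_image, mem_filter, not_exists, not_and, and_imp] at hx
    refine ⟨Function.update c v x, fun a ha b hb hab => ?_⟩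
    have hne := hab.ne
    by_cases h1 : a = v
    · subst h1
      simp only [Function.update_self, Function.update_of_ne hne.symm]
      exact fun h => hx b hb hab h.symm
    · by_cases h2 : b = v
      · subst h2
        simp only [Function.update_self, Function.update_of_ne hne]
        exact hx a ha hab.symm
      · simp only [Function.update_of_ne h1, Function.update_of_ne h2]
        exact hc a (mem_erase.2 ⟨h1, ha⟩) b (mem_erase.2 ⟨h2, hb⟩) hab

end Density

namespace IsCopy

variable {V : Type*} {G : SimpleGraph V} {n : ℕ} {o : GraphOrientation G}
  {σ : Fin (n + 5) → Bool} {f : Fin (n + 5) → V}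

theorem adj_succ (h : IsCopy o σ f) (i : Fin (n + 5)) : G.Adj (f i) (f (i + 1)) := by
  cases hi : σ i
  · exact (o.le ((h.2 i).2 hi)).symm
  · exact o.le ((h.2 i).1 hi)

theorem adj_pred (h : IsCopy o σ f) (i : Fin (n + 5)) : G.Adj (f i) (f (i - 1)) := by
  have := h.adj_succ (i - 1)
  rw [sub_add_cancel] at this
  exact this.symm

theorem succ_ne_pred (h : IsCopy o σ f) (i : Fin (n + 5)) : f (i + 1) ≠ f (i - 1) := by
  intro he
  have h1 := h.1 he
  have h2 : (1 + 1 : Fin (n + 5)) = 0 := by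
    have : i + 1 - (i - 1) = 0 := by rw [h1, sub_self]
    rw [← this]
    abel
  simp [Fin.ext_iff, Fin.val_add, Nat.mod_eq_of_lt (show 2 < n + 5 by omega)] at h2

theorem eq_true (h : IsCopy o σ f) {i : Fin (n + 5)} (hi : o.adj (f i) (f (i + 1))) :
    σ i = true := by
  cases hs : σ i
  · exact absurd ((h.2 i).2 hs) (o.asymm hi)
  · rfl

theorem eq_false (h : IsCopy o σ f) {i : Fin (n + 5)} (hi : o.adj (f (i + 1)) (f i)) :
    σ i = false := by
  cases hs : σ i
  · rfl
  · exact absurd ((h.2 i).1 hs) (o.asymm hi)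

theorem two_le_degIn (h : IsCopy o σ f) {S : Finset V} (hS : ∀ i, f i ∈ S) (i : Fin (n + 5)) :
    2 ≤ degIn G S (f i) := by
  classical
  rw [← Finset.card_pair (h.succ_ne_pred i)]
  refine Finset.card_le_card fun w hw => ?_
  simp only [Finset.mem_insert, Finset.mem_singleton] at hw
  rcases hw with rfl | rfl
  · simp [hS, h.adj_succ]
  · simp [hS, h.adj_pred]

theorem eq_or_eq_of_degIn_eq_two (h : IsCopy o σ f) {S : Finset V} (hS : ∀ i, f i ∈ S)
    {i : Fin (n + 5)} (hd : degIn G S (f i) = 2) {w : V} (hw : w ∈ S) (hadj : G.Adj (f i) w) :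
    w = f (i + 1) ∨ w = f (i - 1) := by
  classical
  have hsub : ({f (i + 1), f (i - 1)} : Finset V) ⊆ {w ∈ S | G.Adj (f i) w} := by
    intro w hw
    simp only [Finset.mem_insert, Finset.mem_singleton] at hw
    rcases hw with rfl | rfl
    · simp [hS, h.adj_succ]
    · simp [hS, h.adj_pred]
  have heq := Finset.eq_of_subset_of_card_le hsub (by
    rw [Finset.card_pair (h.succ_ne_pred i)]
    exact hd.le)
  have : w ∈ ({f (i + 1), f (i - 1)} : Finset V) := by
    rw [heq]
    simp [hw, hadj]
  simpa using this

theorem of_override {R : V → V → Prop} {hR : ∀ u v, R u v → ¬ R v u}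
    (h : IsCopy (o.override R hR) σ f) (hf : ∀ i j, ¬ R (f i) (f j)) : IsCopy o σ f := by
  refine ⟨h.1, fun i => ⟨fun hi => ?_, fun hi => ?_⟩⟩
  · exact (((h.2 i).1 hi).2.resolve_left (hf _ _)).2
  · exact (((h.2 i).2 hi).2.resolve_left (hf _ _)).2

theorem eq_true_of_override {R : V → V → Prop} {hR : ∀ u v, R u v → ¬ R v u}
    (h : IsCopy (o.override R hR) σ f) {i : Fin (n + 5)} (hi : R (f i) (f (i + 1))) :
    σ i = true :=
  h.eq_true ⟨h.adj_succ i, Or.inl hi⟩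

theorem eq_false_of_override {R : V → V → Prop} {hR : ∀ u v, R u v → ¬ R v u}
    (h : IsCopy (o.override R hR) σ f) {i : Fin (n + 5)} (hi : R (f (i + 1)) (f i)) :
    σ i = false :=
  h.eq_false ⟨(h.adj_succ i).symm, Or.inl hi⟩

end IsCopy

/-- The oriented cycle `σ` contains no directed path with three edges. -/
def NoDirectedThreePath {n : ℕ} (σ : Fin (n + 5) → Bool) : Prop :=
  ∀ i, ¬ (σ i = σ (i + 1) ∧ σ (i + 1) = σ (i + 1 + 1))

namespace AvoidableOn

variable {V : Type*} {G : SimpleGraph V} {n : ℕ} {σ : Fin (n + 5) → Bool} {S : Finset V}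

theorem empty : AvoidableOn G σ ∅ := by
  classical
  obtain ⟨r, hr⟩ : ∃ r : V → V → Prop, IsWellOrder V r := ⟨_, WellOrderingRel.isWellOrder⟩
  refine ⟨.ofRel r (fun u v h => asymm_of r h) fun u v h => ?_, fun f _ h => ?_⟩
  · rcases trichotomous_of r u v with h1 | h1 | h1
    · exact Or.inl h1
    · exact absurd h1 h.ne
    · exact Or.inr h1
  · simpa using h 0

theorem of_not (h : AvoidableOn G (fun i => !σ i) S) : AvoidableOn G σ S := by
  obtain ⟨o, ho⟩ := h
  refine ⟨o.reverse, fun f hf => ho f ⟨hf.1, fun i => ⟨fun hi => ?_, fun hi => ?_⟩⟩⟩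
  · exact (hf.2 i).2 (by simpa using hi)
  · exact (hf.2 i).1 (by simpa using hi)

theorem of_erase [DecidableEq V] {v : V} (hd : degIn G S v < 2)
    (h : AvoidableOn G σ (S.erase v)) : AvoidableOn G σ S := by
  obtain ⟨o, ho⟩ := h
  refine ⟨o, fun f hf hS => ho f hf fun i => Finset.mem_erase.2 ⟨?_, hS i⟩⟩
  rintro rfl
  exact absurd (hf.two_le_degIn hS i) (by omega)

theorem exists_other_neighbor {a : V} (hd : degIn G S a = 2) (b : V) :
    ∃ u ∈ S, u ≠ b ∧ G.Adj a u := by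
  classical
  obtain ⟨u, hu, hne⟩ := Finset.exists_mem_ne (by
    unfold degIn at hd
    omega : 1 < Finset.card {w ∈ S | G.Adj a w}) b
  rw [Finset.mem_filter] at hu
  exact ⟨u, hu.1, hne, hu.2⟩

theorem of_erase_thread [DecidableEq V] (hσ : NoDirectedThreePath σ) {a b : V} (ha : a ∈ S)
    (hb : b ∈ S) (hab : G.Adj a b) (hda : degIn G S a = 2) (hdb : degIn G S b = 2)
    (h : AvoidableOn G σ ((S.erase a).erase b)) : AvoidableOn G σ S := by
  obtain ⟨o, ho⟩ := h
  obtain ⟨u, huS, hub, hau⟩ := exists_other_neighbor hda b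
  obtain ⟨v, hvS, hva, hbv⟩ := exists_other_neighbor hdb a
  have hne := hab.ne
  have := hau.ne
  have := hbv.ne
  let R : V → V → Prop := fun x y => (x = u ∧ y = a) ∨ (x = a ∧ y = b) ∨ (x = b ∧ y = v)
  have hR : ∀ x y, R x y → ¬ R y x := by
    simp only [R]
    grind
  refine ⟨o.override R hR, fun f hf hS => ?_⟩
  have not_a : ∀ i, f i ≠ a := by
    rintro i rfl
    have e1 := hf.eq_or_eq_of_degIn_eq_two hS hda huS hau
    rcases hf.eq_or_eq_of_degIn_eq_two hS hda hb hab with rfl | rfl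
    · have hu : u = f (i - 1) := by tauto
      have hv : v = f (i + 1 + 1) := by
        rcases hf.eq_or_eq_of_degIn_eq_two hS hdb hvS hbv with h | h
        · exact h
        · rw [add_sub_cancel_right] at h
          exact absurd h hva
      have h1 := hf.eq_true_of_override (i := i - 1) (by
        rw [sub_add_cancel]
        exact Or.inl ⟨hu.symm, rfl⟩)
      have h2 := hf.eq_true_of_override (i := i) (Or.inr (Or.inl ⟨rfl, rfl⟩))
      have h3 := hf.eq_true_of_override (i := i + 1) (Or.inr (Or.inr ⟨rfl, hv.symm⟩))
      refine hσ (i - 1) ?_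
      rw [sub_add_cancel, h1, h2, h3]
      exact ⟨rfl, rfl⟩
    · have hu : u = f (i + 1) := by tauto
      have hv : v = f (i - 1 - 1) := by
        rcases hf.eq_or_eq_of_degIn_eq_two hS hdb hvS hbv with h | h
        · rw [sub_add_cancel] at h
          exact absurd h hva
        · exact h
      have h1 := hf.eq_false_of_override (i := i - 1 - 1) (by
        rw [sub_add_cancel]
        exact Or.inr (Or.inr ⟨rfl, hv.symm⟩))
      have h2 := hf.eq_false_of_override (i := i - 1) (by
        rw [sub_add_cancel]
        exact Or.inr (Or.inl ⟨rfl, rfl⟩))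
      have h3 := hf.eq_false_of_override (i := i) (Or.inl ⟨hu.symm, rfl⟩)
      refine hσ (i - 1 - 1) ?_
      rw [sub_add_cancel, sub_add_cancel, h1, h2, h3]
      exact ⟨rfl, rfl⟩
  have not_b : ∀ i, f i ≠ b := by
    rintro i rfl
    rcases hf.eq_or_eq_of_degIn_eq_two hS hdb ha hab.symm with h | h
    · exact not_a _ h.symm
    · exact not_a _ h.symm
  refine ho f (hf.of_override fun i j => ?_) fun i => ?_
  · have := not_a i
    have := not_a j
    have := not_b i
    simp only [R]
    tauto
  · simp [not_a, not_b, hS]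

theorem of_erase_claw [DecidableEq V] [DecidableRel G.Adj]
    (hσ : ∀ i, ¬ (σ (i - 1 - 1) = false ∧ σ (i - 1) = false ∧ σ i = true ∧ σ (i + 1) = true))
    {c : V} (hc : c ∈ S) (hdc : ∀ a ∈ S, G.Adj c a → degIn G S a = 2)
    (hindep : ∀ a ∈ S, ∀ b ∈ S, G.Adj a b → degIn G S a = 2 → degIn G S b ≠ 2)
    (h : AvoidableOn G σ ((S.erase c).filter fun v => ¬ G.Adj c v)) :
    AvoidableOn G σ S := by
  obtain ⟨o, ho⟩ := h
  let R : V → V → Prop := fun x y => (x = c ∧ G.Adj c y) ∨ (G.Adj c x ∧ y ≠ c ∧ ¬ G.Adj c y)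
  have hR : ∀ x y, R x y → ¬ R y x := by
    have := G.irrefl (v := c)
    simp only [R]
    grind
  refine ⟨o.override R hR, fun f hf hS => ?_⟩
  have hout : ∀ {i j}, f i = c → G.Adj c (f j) → ∀ k, G.Adj (f j) (f k) → k ≠ i →
      R (f j) (f k) := by
    intro i j hi hj k hjk hk
    refine Or.inr ⟨hj, fun h => hk (hf.1 (h.trans hi.symm)), fun h => ?_⟩
    exact hindep _ (hS j) _ (hS k) hjk (hdc _ (hS j) hj) (hdc _ (hS k) h)
  have not_c : ∀ i, f i ≠ c := by
    intro i hi
    have hs := hf.adj_succ i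
    have hp := hf.adj_pred i
    rw [hi] at hs hp
    have hne2 : i + 1 + 1 ≠ i := fun h => hf.succ_ne_pred (i + 1) (by
      rw [h, add_sub_cancel_right])
    have hne2' : i - 1 - 1 ≠ i := fun h => hf.succ_ne_pred (i - 1) (by
      rw [h, sub_add_cancel])
    refine hσ i ⟨?_, ?_, ?_, ?_⟩
    · refine hf.eq_false_of_override ?_
      rw [sub_add_cancel]
      exact hout hi hp _ (hf.adj_pred _) hne2'
    · refine hf.eq_false_of_override ?_
      rw [sub_add_cancel]
      exact Or.inl ⟨hi, hp⟩
    · exact hf.eq_true_of_override (Or.inl ⟨hi, hs⟩)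
    · exact hf.eq_true_of_override (hout hi hs _ (hf.adj_succ _) hne2)
  have not_adj : ∀ i, ¬ G.Adj c (f i) := by
    intro i hi
    have hc2 := hf.eq_or_eq_of_degIn_eq_two hS (hdc _ (hS i) hi) hc hi.symm
    rcases hc2 with h | h
    · exact not_c _ h.symm
    · exact not_c _ h.symm
  refine ho f (hf.of_override fun i j => ?_) fun i => ?_
  · have := not_c i
    have := not_adj i
    simp only [R]
    tauto
  · simp [not_c, not_adj, hS]

theorem of_density_lt_six_div_five (hσ : NoDirectedThreePath σ)
    (hd : ∀ S : Finset V, S.Nonempty → 5 * ∑ v ∈ S, degIn G S v < 12 * S.card)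
    (S : Finset V) : AvoidableOn G σ S := by
  classical
  induction S using Finset.strongInduction with
  | H S ih =>
    rcases S.eq_empty_or_nonempty with rfl | hS
    · exact empty
    by_cases hmin : ∀ v ∈ S, 2 ≤ degIn G S v
    · obtain ⟨a, ha, b, hb, hab, hda, hdb⟩ := exists_adj_degIn_eq_two (hd S hS) hmin
      exact of_erase_thread hσ ha hb hab hda hdb
        (ih _ ((Finset.erase_subset _ _).trans_ssubset (Finset.erase_ssubset ha)))
    · push Not at hmin
      obtain ⟨v, hv, hdv⟩ := hmin
      exact of_erase hdv (ih _ (Finset.erase_ssubset hv))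

theorem of_density_lt_five_div_four (hσ : NoDirectedThreePath σ)
    (hσ' : ∀ i, ¬ (σ (i - 1 - 1) = false ∧ σ (i - 1) = false ∧ σ i = true ∧ σ (i + 1) = true))
    (hd : ∀ S : Finset V, S.Nonempty → 2 * ∑ v ∈ S, degIn G S v < 5 * S.card)
    (S : Finset V) : AvoidableOn G σ S := by
  classical
  induction S using Finset.strongInduction with
  | H S ih =>
    rcases S.eq_empty_or_nonempty with rfl | hS
    · exact empty
    by_cases hmin : ∀ v ∈ S, 2 ≤ degIn G S v
    · by_cases hthread : ∃ a ∈ S, ∃ b ∈ S, G.Adj a b ∧ degIn G S a = 2 ∧ degIn G S b = 2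
      · obtain ⟨a, ha, b, hb, hab, hda, hdb⟩ := hthread
        exact of_erase_thread hσ ha hb hab hda hdb
          (ih _ ((Finset.erase_subset _ _).trans_ssubset (Finset.erase_ssubset ha)))
      · obtain ⟨c, hc, -, hdc⟩ :=
          (exists_adj_degIn_eq_two_or_claw (hd S hS) hmin).resolve_left hthread
        push Not at hthread
        exact of_erase_claw hσ' hc hdc hthread
          (ih _ ((Finset.filter_subset _ _).trans_ssubset (Finset.erase_ssubset hc)))
    · push Not at hmin
      obtain ⟨v, hv, hdv⟩ := hmin
      exact of_erase hdv (ih _ (Finset.erase_ssubset hv))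

theorem of_coloring_of_directedThreePath (c : V → Fin 3) (hc : ∀ u v, G.Adj u v → c u ≠ c v)
    (hσ : ¬ NoDirectedThreePath σ) : AvoidableOn G σ S := by
  refine ⟨.ofRel (fun u v => c u < c v) (fun u v h => h.asymm)
    fun u v h => lt_or_gt_of_ne (hc u v h), fun f hf _ => hσ fun i ⟨h1, h2⟩ => ?_⟩
  have e1 := hf.2 i
  have e2 := hf.2 (i + 1)
  have e3 := hf.2 (i + 1 + 1)
  rw [h1, h2] at e1
  rw [h2] at e2
  cases h : σ (i + 1 + 1)
  · have := (e1.2 h).2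
    have := (e2.2 h).2
    have := (e3.2 h).2
    omega
  · have := (e1.1 h).2
    have := (e2.1 h).2
    have := (e3.1 h).2
    omega

theorem of_coloring_of_sum_ne_zero (c : V → Fin 3) (hc : ∀ u v, G.Adj u v → c u ≠ c v)
    (hσ : ∑ i, (if σ i then 1 else -1 : Fin 3) ≠ 0) : AvoidableOn G σ S := by
  have h1 : ∀ x y : Fin 3, y = x + 1 → ¬ x = y + 1 := by decide
  have h2 : ∀ x y : Fin 3, x ≠ y → y = x + 1 ∨ x = y + 1 := by decide
  refine ⟨.ofRel (fun u v => c v = c u + 1) (fun u v => h1 _ _)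
    fun u v h => h2 _ _ (hc u v h), fun f hf _ => hσ ?_⟩
  have hstep : ∀ i, c (f (i + 1)) = c (f i) + if σ i then 1 else -1 := by
    intro i
    cases hi : σ i
    · have := ((hf.2 i).2 hi).2
      simp [this]
    · simpa using ((hf.2 i).1 hi).2
  have hsum := Equiv.sum_comp (Equiv.addRight (1 : Fin (n + 5))) fun i => c (f i)
  simp only [Equiv.coe_addRight, hstep, Finset.sum_add_distrib] at hsum
  exact left_eq_add.1 hsum.symm

end AvoidableOn

theorem sum_ne_zero_of_noDirectedThreePath_five (σ : Fin (0 + 5) → Bool)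
    (hσ : NoDirectedThreePath σ) : ∑ i, (if σ i then 1 else -1 : Fin 3) ≠ 0 := by
  unfold NoDirectedThreePath at hσ
  revert σ
  decide

theorem sum_ne_zero_or_of_noDirectedThreePath_six (σ : Fin (1 + 5) → Bool)
    (hσ : NoDirectedThreePath σ) : ∑ i, (if σ i then 1 else -1 : Fin 3) ≠ 0 ∨
      (∀ i, ¬ (σ (i - 1 - 1) = false ∧ σ (i - 1) = false ∧ σ i = true ∧ σ (i + 1) = true)) ∨
      ∀ i, ¬ ((!σ (i - 1 - 1)) = false ∧ (!σ (i - 1)) = false ∧ (!σ i) = true ∧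
        (!σ (i + 1)) = true) := by
  unfold NoDirectedThreePath at hσ
  revert σ
  decide

/-- Let `ℓ = n + 5 ≥ 5` and let `C⃗` be any orientation of the cycle
`C_ℓ` (encoded by `σ : Fin ℓ → Bool`, where `σ i = true` means the edge `{i, i+1}`
is directed `i → i+1`).  If `G` is a graph with `m(G) < (ℓ-1)/(ℓ-2)`, then some
orientation of `G` contains no copy of `C⃗`. -/
theorem not_oriented_ramsey_cycle_ge_5 {V : Type*} [Fintype V]
    (n : ℕ) (σ : Fin (n + 5) → Bool)
    (G : SimpleGraph V)
    (hm : ∀ J : G.Subgraph, J.verts.Nonempty →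
      (J.edgeSet.ncard : ℚ) < (((n : ℚ) + 4) / ((n : ℚ) + 3)) * J.verts.ncard) :
    ∃ o : GraphOrientation G, ¬ ∃ f : Fin (n + 5) → V, Function.Injective f ∧
      ∀ i : Fin (n + 5), (σ i = true → o.adj (f i) (f (i + 1))) ∧
        (σ i = false → o.adj (f (i + 1)) (f i)) := by
  classical
  have hd := density_degIn n hm
  have hd43 : ∀ S : Finset V, S.Nonempty → 3 * ∑ v ∈ S, degIn G S v < 8 * S.card := by
    intro S hS
    have := hd S hS
    nlinarith
  obtain ⟨c, hc⟩ := exists_coloring_three hd43 Finset.univ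
  replace hc : ∀ u v, G.Adj u v → c u ≠ c v := by simpa using hc
  suffices h : AvoidableOn G σ Finset.univ by
    obtain ⟨o, ho⟩ := h
    exact ⟨o, fun ⟨f, hf⟩ => ho f hf fun _ => Finset.mem_univ _⟩
  by_cases hσ : NoDirectedThreePath σ
  swap
  · exact .of_coloring_of_directedThreePath c hc hσ
  match n, σ, hd, hσ with
  | 0, σ, _, hσ =>
    exact .of_coloring_of_sum_ne_zero c hc (sum_ne_zero_of_noDirectedThreePath_five σ hσ)
  | 1, σ, hd, hσ =>
    have hd54 : ∀ S : Finset V, S.Nonempty → 2 * ∑ v ∈ S, degIn G S v < 5 * S.card := by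
      intro S hS
      have := hd S hS
      omega
    rcases sum_ne_zero_or_of_noDirectedThreePath_six σ hσ with h | h | h
    · exact .of_coloring_of_sum_ne_zero c hc h
    · exact .of_density_lt_five_div_four hσ h hd54 _
    · refine .of_not (.of_density_lt_five_div_four (fun i => ?_) h hd54 _)
      simpa using hσ i
  | n + 2, σ, hd, hσ =>
    refine .of_density_lt_six_div_five hσ (fun S hS => ?_) _
    have := hd S hS
    nlinarith
end
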